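/- Let H be the 8-vertex graph with vertices v, v', a1, a2, a3, b1, b2, b3 and edges v a1, a1 a2, a2 a3, a3 b3, b3 b2, b2 b1, b1 a1, a2 b2, b1 v', v' b3 (and no other edges). Then every claw deletion set of H has at least 2 vertices, the set {v, b2} is a claw deletion set of H of size 2, and any claw deletion set of H of size 2 that contains v is equal to {v, b2}. -/

import Mathlib

/-- `G` has an induced subgraph isomorphic to the `d`-claw `K_{1,d}`:
a center `v` together with `d` pairwise nonadjacent leaves adjacent to `v`. -/
def HasNClaw {V : Type*} (G : SimpleGraph V) (d : ℕ) : Prop :=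
  ∃ (v : V) (s : Finset V), s.card = d ∧ v ∉ s ∧ (∀ u ∈ s, G.Adj v u) ∧
    ∀ u ∈ s, ∀ w ∈ s, u ≠ w → ¬ G.Adj u w

/-- `S` is a `d`-claw deletion set of `G`: `G − S` has no induced `K_{1,d}`. -/
def IsClawDeletionSet {V : Type*} (G : SimpleGraph V) (d : ℕ) (S : Set V) : Prop :=
  ¬ HasNClaw (G.induce Sᶜ) d

/-- `S` is a vertex cover of `G`. -/
def IsVertexCoverSet {V : Type*} (G : SimpleGraph V) (S : Set V) : Prop :=
  ∀ ⦃u v⦄, G.Adj u v → u ∈ S ∨ v ∈ S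

/-- The 8-vertex graph `H` with labels `0 = v`, `1 = v'`, `2 = a1`, `3 = a2`, `4 = a3`,
`5 = b1`, `6 = b2`, `7 = b3`, and edges
`v a1, a1 a2, a2 a3, a3 b3, b3 b2, b2 b1, b1 a1, a2 b2, b1 v', v' b3`. -/
def gadgetH : SimpleGraph (Fin 8) :=
  SimpleGraph.fromRel (fun i j =>
    (i, j) ∈ ([(0, 2), (2, 3), (3, 4), (4, 7), (7, 6), (6, 5), (5, 2), (3, 6), (5, 1),
      (1, 7)] : List (Fin 8 × Fin 8)))

instance : DecidableRel gadgetH.Adj :=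
  inferInstanceAs (DecidableRel (SimpleGraph.fromRel _).Adj)

/-- A claw deletion set meets every induced claw. -/
theorem IsClawDeletionSet.mem_of_claw {V : Type*} {G : SimpleGraph V} {S : Set V}
    (hS : IsClawDeletionSet G 3 S) {c x y z : V}
    (hadj : G.Adj c x ∧ G.Adj c y ∧ G.Adj c z) (hne : x ≠ y ∧ x ≠ z ∧ y ≠ z)
    (hnadj : ¬ G.Adj x y ∧ ¬ G.Adj x z ∧ ¬ G.Adj y z) :
    c ∈ S ∨ x ∈ S ∨ y ∈ S ∨ z ∈ S := by
  classical
  by_contra! h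
  obtain ⟨hc, hx, hy, hz⟩ := h
  obtain ⟨hcx, hcy, hcz⟩ := hadj
  obtain ⟨hxy, hxz, hyz⟩ := hne
  obtain ⟨nxy, nxz, nyz⟩ := hnadj
  refine hS ⟨⟨c, hc⟩, {⟨x, hx⟩, ⟨y, hy⟩, ⟨z, hz⟩}, ?_, ?_, ?_, ?_⟩
  · exact Finset.card_eq_three.2 ⟨_, _, _, by simpa using hxy, by simpa using hxz,
      by simpa using hyz, rfl⟩
  · simp [hcx.ne, hcy.ne, hcz.ne]
  · simp [hcx, hcy, hcz]
  · simp [nxy, nxz, nyz, G.adj_comm y x, G.adj_comm z x, G.adj_comm z y]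

/-- If every vertex outside `S` has fewer than `d` neighbours outside `S`, then `S` is a `d`-claw
deletion set. -/
theorem isClawDeletionSet_of_card_lt {V : Type*} [Fintype V] [DecidableEq V]
    {G : SimpleGraph V} [DecidableRel G.Adj] {d : ℕ} {S : Finset V}
    (h : ∀ v ∉ S, (Finset.univ.filter fun u => u ∉ S ∧ G.Adj v u).card < d) :
    IsClawDeletionSet G d (S : Set V) := by
  rintro ⟨⟨v, hv⟩, s, hs, -, hadj, -⟩
  refine (h v (by simpa using hv)).not_ge ?_
  rw [← hs, ← Finset.card_map (Function.Embedding.subtype _)]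
  refine Finset.card_le_card fun u hu => ?_
  obtain ⟨⟨u, huS⟩, hus, rfl⟩ := Finset.mem_map.1 hu
  exact Finset.mem_filter.2 ⟨Finset.mem_univ _, by simpa using huS, hadj _ hus⟩

theorem stmt8 :
    (∀ S : Set (Fin 8), IsClawDeletionSet gadgetH 3 S → 2 ≤ S.ncard) ∧
    IsClawDeletionSet gadgetH 3 {0, 6} ∧ ({0, 6} : Set (Fin 8)).ncard = 2 ∧
    (∀ S : Set (Fin 8), IsClawDeletionSet gadgetH 3 S → S.ncard = 2 → (0 : Fin 8) ∈ S →
      S = {0, 6}) := by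
  refine ⟨fun S hS => ?_, ?_, Set.ncard_pair (by decide), fun S hS hcard h0 => ?_⟩
  · have hleft := hS.mem_of_claw (c := 2) (x := 0) (y := 3) (z := 5)
      (by decide) (by decide) (by decide)
    have hright := hS.mem_of_claw (c := 7) (x := 1) (y := 4) (z := 6)
      (by decide) (by decide) (by decide)
    refine (Set.one_lt_ncard (Set.toFinite S)).2 ?_
    rcases hleft with h | h | h | h <;> rcases hright with h' | h' | h' | h' <;>
      exact ⟨_, h, _, h', by decide⟩
  · have h := isClawDeletionSet_of_card_lt (G := gadgetH) (d := 3) (S := {0, 6}) (by decide)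
    simpa using h
  · obtain ⟨w, hw⟩ : ∃ w, S = {0, w} := by
      obtain ⟨x, y, -, rfl⟩ := Set.ncard_eq_two.1 hcard
      rcases h0 with rfl | rfl
      · exact ⟨y, rfl⟩
      · exact ⟨x, Set.pair_comm _ _⟩
    subst hw
    have ha := hS.mem_of_claw (c := 3) (x := 2) (y := 4) (z := 6)
      (by decide) (by decide) (by decide)
    have hb := hS.mem_of_claw (c := 7) (x := 1) (y := 4) (z := 6)
      (by decide) (by decide) (by decide)
    have hc := hS.mem_of_claw (c := 5) (x := 1) (y := 2) (z := 6)
      (by decide) (by decide) (by decide)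
    have hw : w = 6 := by
      simp only [Set.mem_insert_iff, Set.mem_singleton_iff] at ha hb hc
      clear hS hcard h0
      revert w
      decide
    rw [hw]
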